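/- Graphs generated by the RG-generating algorithm induce the marginal and conditional independence model: for a ribbonless graph H = (N,F) and pairwise disjoint subsets A, B, C, C₁, M of N, A ⊥_m B | C₁ holds in α_RG(H;M,C) if and only if A ⊥_m B | C∪C₁ holds in H. -/

import Mathlib

/-!
Stable mixed graphs: mixed graphs with arrows, arcs and lines; ribbonless,
summary and ancestral graphs; the generating maps α_RG, α_SG, α_AG;
m-connecting paths, m-separation and induced independence models.
-/

namespace StableMixedGraphs

/-- A mixed graph on node type `V`: a node set together with three edge
relations: arrows (`arrow i j` means an arrow from `i` to `j`), arcs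
(two-headed, symmetric) and lines (undirected, symmetric). -/
structure MixedGraph (V : Type) where
  nodes : Set V
  arrow : V → V → Prop
  arc : V → V → Prop
  line : V → V → Prop

namespace MixedGraph

variable {V W : Type}

/-- Wellformedness: arcs and lines are symmetric relations and all edges join
nodes of the graph. -/
def Wf (G : MixedGraph V) : Prop :=
  (∀ i j, G.arc i j → G.arc j i) ∧
  (∀ i j, G.line i j → G.line j i) ∧
  (∀ i j, G.arrow i j ∨ G.arc i j ∨ G.line i j → i ∈ G.nodes ∧ j ∈ G.nodes)

/-- No loops of any of the three kinds. -/
def Loopless (G : MixedGraph V) : Prop :=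
  ∀ i, ¬ G.arrow i i ∧ ¬ G.arc i i ∧ ¬ G.line i i

/-- A loopless mixed graph with a finite node set. -/
def IsLMG (G : MixedGraph V) : Prop := G.Wf ∧ G.Loopless ∧ G.nodes.Finite

/-- `G.anc i j` : `i` is an ancestor of `j`, i.e. there is a
direction-preserving path from `i` to `j`. -/
def anc (G : MixedGraph V) (i j : V) : Prop := Relation.TransGen G.arrow i j

/-- The set of ancestors of nodes of `C`. -/
def anSet (G : MixedGraph V) (C : Set V) : Set V := {a | ∃ c ∈ C, G.anc a c}

/-- `i` lies on a direction-preserving cycle. -/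
def OnDPCycle (G : MixedGraph V) (i : V) : Prop := G.anc i i

/-- `i` is an endpoint of a line. -/
def LineEndpoint (G : MixedGraph V) (i : V) : Prop := ∃ j, G.line i j

/-- Condition (2) of a ribbon: `i` or a descendant of `i` is an endpoint of a
line or lies on a direction-preserving cycle. -/
def RibbonTail (G : MixedGraph V) (i : V) : Prop :=
  ∃ d, (d = i ∨ G.anc i d) ∧ (G.LineEndpoint d ∨ G.OnDPCycle d)

/-- `G` contains a ribbon: a collider V-configuration `⟨h,i,j⟩` with no
endpoint-identical edge between `h` and `j`, whose inner node `i` (or a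
descendant of it) is an endpoint of a line or on a direction-preserving
cycle. -/
def HasRibbon (G : MixedGraph V) : Prop :=
  ∃ h i j, h ≠ i ∧ i ≠ j ∧ h ≠ j ∧ G.RibbonTail i ∧
    ((G.arc h i ∧ G.arc i j ∧ ¬ G.arc h j) ∨
     (G.arrow h i ∧ G.arrow j i ∧ ¬ G.line h j) ∨
     (G.arrow h i ∧ G.arc i j ∧ ¬ G.arrow h j))

/-- A ribbonless graph: a loopless mixed graph with no ribbon. -/
def IsRG (G : MixedGraph V) : Prop := G.IsLMG ∧ ¬ G.HasRibbon

/-- A directed acyclic graph: only arrows, no direction-preserving cycle. -/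
def IsDAG (G : MixedGraph V) : Prop :=
  G.IsLMG ∧ (∀ i j, ¬ G.arc i j) ∧ (∀ i j, ¬ G.line i j) ∧ ∀ i, ¬ G.anc i i

/-- A summary graph: a loopless mixed graph with no arrowhead pointing to an
endpoint of a line and no direction-preserving cycle. -/
def IsSG (G : MixedGraph V) : Prop :=
  G.IsLMG ∧ (∀ i, G.LineEndpoint i → ∀ k, ¬ G.arrow k i ∧ ¬ G.arc k i) ∧
    ∀ i, ¬ G.anc i i

/-- A simple mixed graph: no loops and no multiple edges. -/
def Simple (G : MixedGraph V) : Prop :=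
  G.Loopless ∧ ∀ i j,
    (G.arrow i j → ¬ G.arrow j i ∧ ¬ G.arc i j ∧ ¬ G.line i j) ∧
    (G.arc i j → ¬ G.line i j)

/-- An ancestral graph: a simple mixed graph such that no node is an ancestor
of one of its parents or spouses, and a node with a neighbour has neither
parents nor spouses. -/
def IsAG (G : MixedGraph V) : Prop :=
  G.Wf ∧ G.Simple ∧ G.nodes.Finite ∧
  (∀ i j, G.arrow j i ∨ G.arc j i → ¬ G.anc i j) ∧
  (∀ i, G.LineEndpoint i → ∀ k, ¬ G.arrow k i ∧ ¬ G.arc k i)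

/-- An undirected graph: only lines. -/
def IsUG (G : MixedGraph V) : Prop :=
  G.IsLMG ∧ (∀ i j, ¬ G.arrow i j) ∧ ∀ i j, ¬ G.arc i j

/-- A bidirected graph: only arcs. -/
def IsBG (G : MixedGraph V) : Prop :=
  G.IsLMG ∧ (∀ i j, ¬ G.arrow i j) ∧ ∀ i j, ¬ G.line i j

/-- Image of a mixed graph under a map of node types. -/
def map (f : V → W) (G : MixedGraph V) : MixedGraph W where
  nodes := f '' G.nodes
  arrow a b := ∃ i j, G.arrow i j ∧ f i = a ∧ f j = b
  arc a b := ∃ i j, G.arc i j ∧ f i = a ∧ f j = b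
  line a b := ∃ i j, G.line i j ∧ f i = a ∧ f j = b

end MixedGraph

/-! ### The closure generating new edges (Table 1 of the RG-generating
algorithm), for given marginalisation set `M` and collider set
`S = C ∪ an(C)`.  For every V-configuration whose inner node is a
non-collider in `M` (rows 1–7) or a collider in `S` (rows 8–10) the
endpoint-identical edge between the endpoints is generated, repeatedly
until closure. -/

mutual
  /-- Generated arrows (`GenArrow H M S j i`: arrow from `j` to `i`). -/
  inductive GenArrow {V : Type} (H : MixedGraph V) (M S : Set V) : V → V → Prop
    | base {i j : V} : H.arrow i j → GenArrow H M S i j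
    | row1 {i j m : V} : m ∈ M → j ≠ i →
        GenArrow H M S j m → GenArrow H M S m i → GenArrow H M S j i
    | row2 {i j m : V} : m ∈ M → j ≠ i →
        GenLine H M S j m → GenArrow H M S m i → GenArrow H M S j i
    | row3 {i j m : V} : m ∈ M → j ≠ i →
        GenLine H M S j m → GenArc H M S m i → GenArrow H M S j i
    | row8 {i j s : V} : s ∈ S → j ≠ i →
        GenArrow H M S j s → GenArc H M S s i → GenArrow H M S j i

  /-- Generated arcs. -/
  inductive GenArc {V : Type} (H : MixedGraph V) (M S : Set V) : V → V → Prop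
    | base {i j : V} : H.arc i j → GenArc H M S i j
    | symm {i j : V} : GenArc H M S i j → GenArc H M S j i
    | row4 {i j m : V} : m ∈ M → i ≠ j →
        GenArrow H M S m i → GenArrow H M S m j → GenArc H M S i j
    | row5 {i j m : V} : m ∈ M → i ≠ j →
        GenArrow H M S m i → GenArc H M S m j → GenArc H M S i j
    | row9 {i j s : V} : s ∈ S → i ≠ j →
        GenArc H M S i s → GenArc H M S s j → GenArc H M S i j

  /-- Generated lines. -/
  inductive GenLine {V : Type} (H : MixedGraph V) (M S : Set V) : V → V → Prop
    | base {i j : V} : H.line i j → GenLine H M S i j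
    | symm {i j : V} : GenLine H M S i j → GenLine H M S j i
    | row6 {i j m : V} : m ∈ M → i ≠ j →
        GenLine H M S i m → GenArrow H M S j m → GenLine H M S i j
    | row7 {i j m : V} : m ∈ M → i ≠ j →
        GenLine H M S i m → GenLine H M S m j → GenLine H M S i j
    | row10 {i j s : V} : s ∈ S → i ≠ j →
        GenArrow H M S i s → GenArrow H M S j s → GenLine H M S i j
end

variable {V : Type}

/-- The RG-generating map `α_RG(H;M,C)`: generate all edges of the closure
and delete the nodes of `M ∪ C`. -/
def alphaRG (H : MixedGraph V) (M C : Set V) : MixedGraph V where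
  nodes := H.nodes \ (M ∪ C)
  arrow i j := i ∈ H.nodes \ (M ∪ C) ∧ j ∈ H.nodes \ (M ∪ C) ∧
    GenArrow H M (C ∪ H.anSet C) i j
  arc i j := i ∈ H.nodes \ (M ∪ C) ∧ j ∈ H.nodes \ (M ∪ C) ∧
    GenArc H M (C ∪ H.anSet C) i j
  line i j := i ∈ H.nodes \ (M ∪ C) ∧ j ∈ H.nodes \ (M ∪ C) ∧
    GenLine H M (C ∪ H.anSet C) i j

/-- The arrowhead-removal operation `α_RG.SG(K;A)`: every arrowhead pointing
at a node of `A` is removed (an arrow at such a node becomes a line, an arc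
becomes an arrow, an arc with both endpoints in `A` becomes a line),
repeatedly until closure. -/
def deheadAt (K : MixedGraph V) (A : Set V) : MixedGraph V where
  nodes := K.nodes
  arrow j i := i ∉ A ∧ (K.arrow j i ∨ (K.arc j i ∧ j ∈ A))
  arc i j := K.arc i j ∧ i ∉ A ∧ j ∉ A
  line i j := K.line i j ∨ (K.arrow j i ∧ i ∈ A) ∨ (K.arrow i j ∧ j ∈ A) ∨
    (K.arc i j ∧ i ∈ A ∧ j ∈ A)

/-- The SG-generating map `α_SG(H;M,C)`: mark the nodes of `an(C)`, apply the
RG-generating construction, then remove all arrowheads pointing at marked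
nodes. -/
def alphaSG (H : MixedGraph V) (M C : Set V) : MixedGraph V :=
  deheadAt (alphaRG H M C) (H.anSet C)

/-! ### Step 2 of the AG-generating algorithm: for every V-configuration
`j → k ↔ i` or `j ↔ k ↔ i` with `k ∈ an(i)` (in the current graph) generate
an arrow from `j` to `i`, respectively an arc between `j` and `i`, until
closure. -/

mutual
  inductive AG2Arrow {V : Type} (K : MixedGraph V) : V → V → Prop
    | base {i j : V} : K.arrow j i → AG2Arrow K j i
    | gen {i j k : V} : j ≠ i → AG2Arrow K j k → AG2Arc K k i →
        AG2Anc K k i → AG2Arrow K j i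

  inductive AG2Arc {V : Type} (K : MixedGraph V) : V → V → Prop
    | base {i j : V} : K.arc i j → AG2Arc K i j
    | symm {i j : V} : AG2Arc K i j → AG2Arc K j i
    | gen {i j k : V} : j ≠ i → AG2Arc K j k → AG2Arc K k i →
        AG2Anc K k i → AG2Arc K j i

  /-- The ancestor relation of the graph being generated in step 2. -/
  inductive AG2Anc {V : Type} (K : MixedGraph V) : V → V → Prop
    | single {i j : V} : AG2Arrow K i j → AG2Anc K i j
    | tail {i k j : V} : AG2Arrow K i k → AG2Anc K k j → AG2Anc K i j
end

/-- The graph after step 2 of the AG-generating algorithm. -/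
def ag2 (K : MixedGraph V) : MixedGraph V where
  nodes := K.nodes
  arrow := AG2Arrow K
  arc := AG2Arc K
  line := K.line

/-! ### Step 3 of the AG-generating algorithm: repeatedly replace every arc
between `j` and `i` with `j ∈ an(i)` (in the current graph) by an arrow from
`j` to `i`. -/

mutual
  inductive AG3Arrow {V : Type} (K : MixedGraph V) : V → V → Prop
    | base {i j : V} : K.arrow j i → AG3Arrow K j i
    | conv {i j : V} : K.arc j i → AG3Anc K j i → AG3Arrow K j i

  /-- The ancestor relation of the graph being generated in step 3. -/
  inductive AG3Anc {V : Type} (K : MixedGraph V) : V → V → Prop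
    | single {i j : V} : AG3Arrow K i j → AG3Anc K i j
    | tail {i k j : V} : AG3Arrow K i k → AG3Anc K k j → AG3Anc K i j
end

/-- Steps 2 and 3 of the AG-generating algorithm, applied to a summary
graph: `α_SG.AG`. -/
def alphaSGAG (K : MixedGraph V) : MixedGraph V :=
  let K2 := ag2 K
  { nodes := K.nodes
    arrow := AG3Arrow K2
    arc := fun i j => K2.arc i j ∧ ¬ AG3Anc K2 i j ∧ ¬ AG3Anc K2 j i
    line := K.line }

/-- The AG-generating map `α_AG(H;M,C)`. -/
def alphaAG (H : MixedGraph V) (M C : Set V) : MixedGraph V :=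
  alphaSGAG (alphaSG H M C)

/-! ### Paths, m-connection and m-separation. -/

/-- A step of a walk: it goes from `src` to `tgt` along an edge which has an
arrowhead at `src` iff `hs = true` and an arrowhead at `tgt` iff
`ht = true` (so `hs = ht = false` is a line, `hs = ht = true` an arc, and
exactly one head an arrow in the corresponding direction). -/
structure Step (V : Type) where
  src : V
  tgt : V
  hs : Bool
  ht : Bool

/-- The edge of a step is present in `G`. -/
def Step.valid (G : MixedGraph V) (s : Step V) : Prop :=
  match s.hs, s.ht with
  | false, false => G.line s.src s.tgt
  | false, true  => G.arrow s.src s.tgt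
  | true,  false => G.arrow s.tgt s.src
  | true,  true  => G.arc s.src s.tgt

/-- `w` is a path from `i` to `j` in `G`: a nonempty chained list of valid
steps with no repeated nodes. -/
def IsPath (G : MixedGraph V) (i j : V) (w : List (Step V)) : Prop :=
  w ≠ [] ∧ (∀ s ∈ w, s.valid G) ∧ List.Chain' (fun a b => a.tgt = b.src) w ∧
    w.head?.map Step.src = some i ∧ w.getLast?.map Step.tgt = some j ∧
    (i :: w.map Step.tgt).Nodup

/-- The path `w` is m-connecting given `M` and `C`: every inner collider node
is in `C ∪ an(C)` and every inner non-collider node is in `M`. -/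
def MConnPath (G : MixedGraph V) (M C : Set V) (w : List (Step V)) : Prop :=
  List.Chain'
    (fun a b =>
      (a.ht = true ∧ b.hs = true → a.tgt ∈ C ∪ G.anSet C) ∧
      (¬ (a.ht = true ∧ b.hs = true) → a.tgt ∈ M)) w

/-- `A ⊥_m B | C` in `G` : there is no m-connecting path between `A` and `B`
given `C` (with `M` the remaining nodes). -/
def MSep (G : MixedGraph V) (A B C : Set V) : Prop :=
  ∀ i ∈ A, ∀ j ∈ B, ∀ w : List (Step V),
    IsPath G i j w → ¬ MConnPath G (G.nodes \ (A ∪ B ∪ C)) C w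

/-- The independence model induced by `G` via m-separation: the set of
triples `⟨A,B|C⟩` of pairwise disjoint subsets of the nodes with
`A ⊥_m B | C`. -/
def Jm (G : MixedGraph V) : Set (Set V × Set V × Set V) :=
  {t | t.1 ⊆ G.nodes ∧ t.2.1 ⊆ G.nodes ∧ t.2.2 ⊆ G.nodes ∧
    Disjoint t.1 t.2.1 ∧ Disjoint t.1 t.2.2 ∧ Disjoint t.2.1 t.2.2 ∧
    MSep G t.1 t.2.1 t.2.2}

/-- The independence model after marginalisation over `M` and conditioning on
`C` : `α(J;M,C)`. -/
def alphaIM (J : Set (Set V × Set V × Set V)) (M C : Set V) :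
    Set (Set V × Set V × Set V) :=
  {t | (t.1, t.2.1, t.2.2 ∪ C) ∈ J ∧ (t.1 ∪ t.2.1 ∪ t.2.2) ∩ (M ∪ C) = ∅}

/-! ### Sized closure and walks -/

/-- `Edge G i j a b`: `G` has an edge between `i` and `j` with an arrowhead at `i` iff `a`
and an arrowhead at `j` iff `b`. -/
def Edge (G : MixedGraph V) (i j : V) (a b : Bool) : Prop := Step.valid G ⟨i, j, a, b⟩

/-- A node `v` met with marks `c` and `d` is passable: it lies in `S` if it is a collider
and in `M` otherwise. -/
def Passes (M S : Set V) (v : V) (c d : Bool) : Prop :=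
  (c = true ∧ d = true → v ∈ S) ∧ (¬ (c = true ∧ d = true) → v ∈ M)

/-- The closure of the edges of `H` under bridging passable nodes, with endpoint marks and
the number of edges of `H` used. -/
inductive GenEdge (H : MixedGraph V) (M S : Set V) : ℕ → V → V → Bool → Bool → Prop
  | base {i j : V} {a b : Bool} : Edge H i j a b → GenEdge H M S 1 i j a b
  | comp {i m j : V} {a b c d : Bool} {p q : ℕ} : i ≠ j → Passes M S m c d →
      GenEdge H M S p i m a c → GenEdge H M S q m j d b → GenEdge H M S (p + q) i j a b

theorem Edge.symm {G : MixedGraph V} (hG : G.Wf) {i j : V} {a b : Bool}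
    (h : Edge G i j a b) : Edge G j i b a := by
  obtain ⟨h1, h2, -⟩ := hG
  cases a <;> cases b <;> simp only [Edge, Step.valid] at h ⊢
  · exact h2 _ _ h
  · exact h
  · exact h
  · exact h1 _ _ h

theorem Edge.mem {G : MixedGraph V} (hG : G.Wf) {i j : V} {a b : Bool}
    (h : Edge G i j a b) : i ∈ G.nodes ∧ j ∈ G.nodes := by
  obtain ⟨-, -, h3⟩ := hG
  cases a <;> cases b <;> simp only [Edge, Step.valid] at h
  · exact h3 _ _ (Or.inr (Or.inr h))
  · exact h3 _ _ (Or.inl h)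
  · exact (h3 _ _ (Or.inl h)).symm
  · exact h3 _ _ (Or.inr (Or.inl h))

theorem Edge.ne {G : MixedGraph V} (hG : G.Loopless) {i j : V} {a b : Bool}
    (h : Edge G i j a b) : i ≠ j := by
  rintro rfl
  obtain ⟨h1, h2, h3⟩ := hG i
  cases a <;> cases b <;> simp_all [Edge, Step.valid]

theorem Passes.symm {M S : Set V} {v : V} {c d : Bool} (h : Passes M S v c d) :
    Passes M S v d c := by
  unfold Passes at *
  rwa [and_comm (a := d = true)]

theorem Passes.cases_of_not_passes {M S : Set V} {v : V} {a b c d : Bool}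
    (h1 : Passes M S v a b) (h2 : Passes M S v c d) (h : ¬ Passes M S v a d) :
    a = true ∧ d = true ∧ b = false ∧ c = false ∧ v ∉ S := by
  unfold Passes at *
  cases a <;> cases b <;> cases c <;> cases d <;> simp_all

namespace GenEdge

variable {H : MixedGraph V} {M S : Set V}

theorem symm (hH : H.Wf) {n : ℕ} {i j : V} {a b : Bool} (h : GenEdge H M S n i j a b) :
    GenEdge H M S n j i b a := by
  induction h with
  | base h => exact .base (h.symm hH)
  | comp hne hp _ _ ih1 ih2 =>
    rw [add_comm]
    exact .comp hne.symm hp.symm ih2 ih1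

theorem mem (hH : H.Wf) {n : ℕ} {i j : V} {a b : Bool} (h : GenEdge H M S n i j a b) :
    i ∈ H.nodes ∧ j ∈ H.nodes := by
  induction h with
  | base h => exact h.mem hH
  | comp _ _ _ _ ih1 ih2 => exact ⟨ih1.1, ih2.2⟩

theorem ne (hH : H.Loopless) {n : ℕ} {i j : V} {a b : Bool} (h : GenEdge H M S n i j a b) :
    i ≠ j := by
  cases h with
  | base h => exact h.ne hH
  | comp hne => exact hne

theorem pos {n : ℕ} {i j : V} {a b : Bool} (h : GenEdge H M S n i j a b) : 0 < n := by
  induction h with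
  | base => exact Nat.one_pos
  | comp _ _ _ _ ih1 _ => omega

/-- With nothing to bridge, the closure adds no edge. -/
theorem edge_of_empty {n : ℕ} {i j : V} {a b : Bool} (h : GenEdge H ∅ ∅ n i j a b) :
    Edge H i j a b := by
  cases h with
  | base h => exact h
  | @comp i m j a b c d p q _ hp =>
    by_cases hcd : c = true ∧ d = true
    · exact (hp.1 hcd).elim
    · exact (hp.2 hcd).elim

/-- The graph of generated edges of type `a b`, in the vocabulary of `GenArrow`, `GenArc`
and `GenLine`. -/
theorem toGen {n : ℕ} {i j : V} {a b : Bool} (h : GenEdge H M S n i j a b) :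
    match a, b with
    | false, false => GenLine H M S i j
    | false, true => GenArrow H M S i j
    | true, false => GenArrow H M S j i
    | true, true => GenArc H M S i j := by
  induction h with
  | @base i j a b h =>
    cases a <;> cases b <;> simp only [Edge, Step.valid] at h ⊢
    · exact .base h
    · exact .base h
    · exact .base h
    · exact .base h
  | @comp i m j a b c d p q hne hp _ _ ih1 ih2 =>
    cases c <;> cases d
    · have hm : m ∈ M := hp.2 (by simp)
      cases a <;> cases b <;> simp only at ih1 ih2 ⊢
      · exact .row7 hm hne ih1 ih2
      · exact .row2 hm hne ih1 ih2
      · exact .row2 hm hne.symm (.symm ih2) ih1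
      · exact .row4 hm hne ih1 ih2
    · have hm : m ∈ M := hp.2 (by simp)
      cases a <;> cases b <;> simp only at ih1 ih2 ⊢
      · exact .row6 hm hne ih1 ih2
      · exact .row3 hm hne ih1 ih2
      · exact .row1 hm hne.symm ih2 ih1
      · exact .row5 hm hne ih1 ih2
    · have hm : m ∈ M := hp.2 (by simp)
      cases a <;> cases b <;> simp only at ih1 ih2 ⊢
      · exact .symm (.row6 hm hne.symm (.symm ih2) ih1)
      · exact .row1 hm hne ih1 ih2
      · exact .row3 hm hne.symm (.symm ih2) (.symm ih1)
      · exact .symm (.row5 hm hne.symm ih2 (.symm ih1))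
    · have hm : m ∈ S := hp.1 (by simp)
      cases a <;> cases b <;> simp only at ih1 ih2 ⊢
      · exact .row10 hm hne ih1 ih2
      · exact .row8 hm hne ih1 ih2
      · exact .row8 hm hne.symm ih2 (.symm ih1)
      · exact .row9 hm hne ih1 ih2

end GenEdge

section OfGen

variable {H : MixedGraph V} {M S : Set V}

mutual

theorem GenArrow.exists_genEdge (hH : H.Wf) {i j : V} :
    GenArrow H M S i j → ∃ n, GenEdge H M S n i j false true
  | .base h => ⟨1, .base h⟩
  | .row1 hm hne h1 h2 => by
    obtain ⟨_, e1⟩ := GenArrow.exists_genEdge hH h1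
    obtain ⟨_, e2⟩ := GenArrow.exists_genEdge hH h2
    exact ⟨_, .comp hne (by simp [Passes, hm]) e1 e2⟩
  | .row2 hm hne h1 h2 => by
    obtain ⟨_, e1⟩ := GenLine.exists_genEdge hH h1
    obtain ⟨_, e2⟩ := GenArrow.exists_genEdge hH h2
    exact ⟨_, .comp hne (by simp [Passes, hm]) e1 e2⟩
  | .row3 hm hne h1 h2 => by
    obtain ⟨_, e1⟩ := GenLine.exists_genEdge hH h1
    obtain ⟨_, e2⟩ := GenArc.exists_genEdge hH h2
    exact ⟨_, .comp hne (by simp [Passes, hm]) e1 e2⟩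
  | .row8 hs hne h1 h2 => by
    obtain ⟨_, e1⟩ := GenArrow.exists_genEdge hH h1
    obtain ⟨_, e2⟩ := GenArc.exists_genEdge hH h2
    exact ⟨_, .comp hne (by simp [Passes, hs]) e1 e2⟩

theorem GenArc.exists_genEdge (hH : H.Wf) {i j : V} :
    GenArc H M S i j → ∃ n, GenEdge H M S n i j true true
  | .base h => ⟨1, .base h⟩
  | .symm h => by
    obtain ⟨_, e⟩ := GenArc.exists_genEdge hH h
    exact ⟨_, e.symm hH⟩
  | .row4 hm hne h1 h2 => by
    obtain ⟨_, e1⟩ := GenArrow.exists_genEdge hH h1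
    obtain ⟨_, e2⟩ := GenArrow.exists_genEdge hH h2
    exact ⟨_, .comp hne (by simp [Passes, hm]) (e1.symm hH) e2⟩
  | .row5 hm hne h1 h2 => by
    obtain ⟨_, e1⟩ := GenArrow.exists_genEdge hH h1
    obtain ⟨_, e2⟩ := GenArc.exists_genEdge hH h2
    exact ⟨_, .comp hne (by simp [Passes, hm]) (e1.symm hH) e2⟩
  | .row9 hs hne h1 h2 => by
    obtain ⟨_, e1⟩ := GenArc.exists_genEdge hH h1
    obtain ⟨_, e2⟩ := GenArc.exists_genEdge hH h2
    exact ⟨_, .comp hne (by simp [Passes, hs]) e1 e2⟩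

theorem GenLine.exists_genEdge (hH : H.Wf) {i j : V} :
    GenLine H M S i j → ∃ n, GenEdge H M S n i j false false
  | .base h => ⟨1, .base h⟩
  | .symm h => by
    obtain ⟨_, e⟩ := GenLine.exists_genEdge hH h
    exact ⟨_, e.symm hH⟩
  | .row6 hm hne h1 h2 => by
    obtain ⟨_, e1⟩ := GenLine.exists_genEdge hH h1
    obtain ⟨_, e2⟩ := GenArrow.exists_genEdge hH h2
    exact ⟨_, .comp hne (by simp [Passes, hm]) e1 (e2.symm hH)⟩
  | .row7 hm hne h1 h2 => by
    obtain ⟨_, e1⟩ := GenLine.exists_genEdge hH h1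
    obtain ⟨_, e2⟩ := GenLine.exists_genEdge hH h2
    exact ⟨_, .comp hne (by simp [Passes, hm]) e1 e2⟩
  | .row10 hs hne h1 h2 => by
    obtain ⟨_, e1⟩ := GenArrow.exists_genEdge hH h1
    obtain ⟨_, e2⟩ := GenArrow.exists_genEdge hH h2
    exact ⟨_, .comp hne (by simp [Passes, hs]) e1 (e2.symm hH)⟩

end

theorem edge_alphaRG_iff (hH : H.Wf) {C : Set V} {i j : V} {a b : Bool} :
    Edge (alphaRG H M C) i j a b ↔ i ∈ (alphaRG H M C).nodes ∧ j ∈ (alphaRG H M C).nodes ∧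
      ∃ n, GenEdge H M (C ∪ H.anSet C) n i j a b := by
  constructor
  · intro h
    cases a <;> cases b <;> obtain ⟨hi, hj, h⟩ := h
    · exact ⟨hi, hj, h.exists_genEdge hH⟩
    · exact ⟨hi, hj, h.exists_genEdge hH⟩
    · obtain ⟨n, e⟩ := h.exists_genEdge hH
      exact ⟨hj, hi, n, e.symm hH⟩
    · exact ⟨hi, hj, h.exists_genEdge hH⟩
  · rintro ⟨hi, hj, n, h⟩
    have h := h.toGen
    cases a <;> cases b
    · exact ⟨hi, hj, h⟩
    · exact ⟨hi, hj, h⟩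
    · exact ⟨hj, hi, h⟩
    · exact ⟨hi, hj, h⟩

end OfGen

/-! ### Ribbons in the closure -/

section Bypass

variable {H : MixedGraph V} {M S : Set V}

theorem ribbonTail_of_anc {u v : V} (h : H.anc u v) (hv : H.RibbonTail v) : H.RibbonTail u := by
  obtain ⟨d, hd, hd'⟩ := hv
  refine ⟨d, Or.inr ?_, hd'⟩
  obtain rfl | hd := hd
  · exact h
  · exact h.trans hd

/-- A generated edge without arrowhead at `i` starts with a direction-preserving path that
ends in `S`, at a line, or at the other endpoint. -/
theorem GenEdge.tail_cases (hS : ∀ u v, H.anc u v → v ∈ S → u ∈ S) {n : ℕ} {i j : V}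
    {a b : Bool} (h : GenEdge H M S n i j a b) (ha : a = false) :
    i ∈ S ∨ H.RibbonTail i ∨ (b = true ∧ H.anc i j) := by
  induction h with
  | @base i j a b h =>
    subst ha
    cases b
    · exact Or.inr (Or.inl ⟨i, Or.inl rfl, Or.inl ⟨j, h⟩⟩)
    · exact Or.inr (Or.inr ⟨rfl, .single h⟩)
  | @comp i m j a b c d p q _ hp _ _ ih1 ih2 =>
    obtain h1 | h1 | ⟨rfl, h1⟩ := ih1 ha
    · exact Or.inl h1
    · exact Or.inr (Or.inl h1)
    · cases d
      · obtain h2 | h2 | ⟨rfl, h2⟩ := ih2 rfl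
        · exact Or.inl (hS _ _ h1 h2)
        · exact Or.inr (Or.inl (ribbonTail_of_anc h1 h2))
        · exact Or.inr (Or.inr ⟨rfl, h1.trans h2⟩)
      · exact Or.inl (hS _ _ h1 (hp.1 ⟨rfl, rfl⟩))

/-- Outcomes of bypassing the inner node of a generated collider V-configuration between `h`
and `j`: the endpoint-identical edge, or an edge with a changed mark at an endpoint that
can absorb the change. -/
def Bypass (H : MixedGraph V) (M S : Set V) (p q : ℕ) (h j : V) (a b : Bool) : Prop :=
  (∃ r, GenEdge H M S r h j a b) ∨
  (∃ r c, r ≤ p ∧ GenEdge H M S r h j a c ∧ (j ∈ M ∨ (j ∈ S ∧ c = true))) ∨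
  (∃ r c, r ≤ q ∧ GenEdge H M S r h j c b ∧ (h ∈ M ∨ (h ∈ S ∧ c = true)))

theorem Bypass.symm (hH : H.Wf) {p q : ℕ} {h j : V} {a b : Bool}
    (hb : Bypass H M S p q h j a b) : Bypass H M S q p j h b a := by
  obtain ⟨r, e⟩ | ⟨r, c, hr, e, hc⟩ | ⟨r, c, hr, e, hc⟩ := hb
  · exact Or.inl ⟨r, e.symm hH⟩
  · exact Or.inr (Or.inr ⟨r, c, hr, e.symm hH, hc⟩)
  · exact Or.inr (Or.inl ⟨r, c, hr, e.symm hH, hc⟩)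

theorem bypass_of_edges (hH : H.IsRG) {h v j : V} {a b : Bool} (hv : H.RibbonTail v)
    (e1 : Edge H h v a true) (e2 : Edge H j v b true) (hne : h ≠ j) : Edge H h j a b := by
  obtain ⟨⟨hwf, hloop, -⟩, hrib⟩ := hH
  have n1 := e1.ne hloop
  have n2 := e2.ne hloop
  by_contra hcon
  cases a <;> cases b
  · exact hrib ⟨h, v, j, n1, n2.symm, hne, hv, Or.inr (Or.inl ⟨e1, e2, hcon⟩)⟩
  · exact hrib ⟨h, v, j, n1, n2.symm, hne, hv, Or.inr (Or.inr ⟨e1, e2.symm hwf, hcon⟩)⟩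
  · exact hrib ⟨j, v, h, n2, n1.symm, hne.symm, hv,
      Or.inr (Or.inr ⟨e2, e1.symm hwf, hcon⟩)⟩
  · exact hrib ⟨h, v, j, n1, n2.symm, hne, hv, Or.inl ⟨e1, e2.symm hwf, hcon⟩⟩

theorem bypass (hH : H.IsRG) (hS : ∀ u v, H.anc u v → v ∈ S → u ∈ S) {n : ℕ} :
    ∀ {p q : ℕ} {h v j : V} {a b : Bool}, p + q ≤ n → H.RibbonTail v →
      GenEdge H M S p h v a true → GenEdge H M S q j v b true → h ≠ j →
      Bypass H M S p q h j a b := by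
  have hwf : H.Wf := hH.1.1
  induction n with
  | zero =>
    intro p q h v j a b hpq _ e1
    have := e1.pos
    omega
  | succ n ih =>
    have key : ∀ {p₁ p₂ q : ℕ} {h m v j : V} {a b c d : Bool}, p₁ + p₂ + q ≤ n + 1 →
        H.RibbonTail v → Passes M S m c d → GenEdge H M S p₁ h m a c →
        GenEdge H M S p₂ m v d true → GenEdge H M S q j v b true → h ≠ j →
        Bypass H M S (p₁ + p₂) q h j a b := by
      intro p₁ p₂ q h m v j a b c d hpq hv hp e1 e2 e3 hne
      have hp1 := e1.pos
      have hp2 := e2.pos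
      by_cases hmj : m = j
      · subst hmj
        refine Or.inr (Or.inl ⟨p₁, c, by omega, e1, ?_⟩)
        by_cases hm : m ∈ M
        · exact Or.inl hm
        · have hcd : c = true ∧ d = true := by
            by_contra hcd
            exact hm (hp.2 hcd)
          exact Or.inr ⟨hp.1 hcd, hcd.1⟩
      obtain ⟨r, e⟩ | ⟨r, c', hr, e, hc⟩ | ⟨r, c', hr, e, hc⟩ :=
        ih (by omega : p₂ + q ≤ n) hv e2 e3 hmj
      · exact Or.inl ⟨_, .comp hne hp e1 e⟩
      · exact Or.inr (Or.inl ⟨_, c', by omega, .comp hne hp e1 e, hc⟩)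
      · by_cases hpass : Passes M S m c c'
        · exact Or.inl ⟨_, .comp hne hpass e1 e⟩
        have hfail : c = true ∧ c' = true ∧ d = false ∧ m ∈ M ∧ m ∉ S := by
          unfold Passes at hp hpass
          cases c <;> cases c' <;> cases d <;> simp_all
        obtain ⟨rfl, rfl, rfl, hmM, hmS⟩ := hfail
        have hm : H.RibbonTail m := by
          obtain h2 | h2 | ⟨-, h2⟩ := e2.tail_cases hS rfl
          · exact (hmS h2).elim
          · exact h2
          · exact ribbonTail_of_anc h2 hv
        obtain h' | ⟨r', c', hr', e', hc'⟩ | ⟨r', c', hr', e', hc'⟩ :=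
          ih (by omega : p₁ + r ≤ n) hm e1 (e.symm hwf) hne
        · exact Or.inl h'
        · exact Or.inr (Or.inl ⟨r', c', by omega, e', hc'⟩)
        · exact Or.inr (Or.inr ⟨r', c', by omega, e', hc'⟩)
    intro p q h v j a b hpq hv e1 e2 hne
    have e1' := e1
    have e2' := e2
    cases e1 with
    | comp _ hp f1 f2 => exact key hpq hv hp f1 f2 e2' hne
    | base f =>
      cases e2 with
      | comp _ hp g1 g2 =>
        exact (key (by omega) hv hp g1 g2 e1' hne.symm).symm hwf
      | base g => exact Or.inl ⟨1, .base (bypass_of_edges hH hv f g hne)⟩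

end Bypass

/-! ### Walks -/

/-- `Reach E Q A n u b`: a walk with `n` steps along `E` leads from `A` to `u`, arriving with
mark `b`, and all its inner nodes satisfy `Q`. -/
inductive Reach (E : V → V → Bool → Bool → Prop) (Q : V → Bool → Bool → Prop) (A : Set V) :
    ℕ → V → Bool → Prop
  | start {i u : V} {a b : Bool} : i ∈ A → E i u a b → Reach E Q A 1 u b
  | step {n : ℕ} {u w : V} {b c d : Bool} : Reach E Q A n u b → Q u b c → E u w c d →
      Reach E Q A (n + 1) w d

/-- The `n`-step walk through `v 0, …, v n` with edges in `E` whose `t`-th edge has marks `p t`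
and `q t` starts in `A` and has inner nodes satisfying `Q`. -/
structure IsWalk (E : V → V → Bool → Bool → Prop) (Q : V → Bool → Bool → Prop) (A : Set V)
    (n : ℕ) (v : ℕ → V) (p q : ℕ → Bool) : Prop where
  start : v 0 ∈ A
  edge : ∀ t < n, E (v t) (v (t + 1)) (p t) (q t)
  inner : ∀ t, t + 1 < n → Q (v (t + 1)) (q t) (p (t + 1))

section Walk

variable {E : V → V → Bool → Bool → Prop} {Q : V → Bool → Bool → Prop} {A : Set V}

theorem Reach.pos {n : ℕ} {u : V} {b : Bool} (h : Reach E Q A n u b) : 0 < n := by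
  cases h <;> omega

theorem Reach.mono {E' : V → V → Bool → Bool → Prop} (hE : ∀ i j a b, E i j a b → E' i j a b)
    {n : ℕ} {u : V} {b : Bool} (h : Reach E Q A n u b) : Reach E' Q A n u b := by
  induction h with
  | start hi he => exact .start hi (hE _ _ _ _ he)
  | step _ hq he ih => exact .step ih hq (hE _ _ _ _ he)

theorem Reach.exists_isWalk {n : ℕ} {u : V} {b : Bool} (h : Reach E Q A n u b) :
    ∃ v p q, IsWalk E Q A n v p q ∧ v n = u ∧ q (n - 1) = b := by
  induction h with
  | @start i u a b hi he =>
    refine ⟨fun t => if t = 0 then i else u, fun _ => a, fun _ => b, ⟨?_, ?_, ?_⟩, ?_, rfl⟩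
    · simpa using hi
    · intro t ht
      obtain rfl : t = 0 := by omega
      simpa using he
    · intro t ht
      omega
    · simp
  | @step n u w b c d hr hq he ih =>
    obtain ⟨v, p, q, ⟨hs, hedge, hinner⟩, hv, hb⟩ := ih
    have hn := hr.pos
    refine ⟨fun t => if t ≤ n then v t else w, fun t => if t < n then p t else c,
      fun t => if t < n then q t else d, ⟨?_, ?_, ?_⟩, ?_, ?_⟩
    · simpa using hs
    · intro t ht
      obtain ht | rfl := Nat.lt_succ_iff_lt_or_eq.1 ht
      · simpa [ht, ht.le, Nat.succ_le_of_lt ht] using hedge t ht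
      · simpa [hv] using he
    · intro t ht
      obtain ht' | ht' := Nat.lt_or_ge (t + 1) n
      · have h1 : t < n := by omega
        simpa [ht', h1, ht'.le] using hinner t ht'
      · obtain rfl : n = t + 1 := by omega
        simp only [Nat.add_sub_cancel] at hb
        simpa [hv, hb] using hq
    · simp
    · simp

variable {n : ℕ} {v : ℕ → V} {p q : ℕ → Bool}

theorem IsWalk.reach (h : IsWalk E Q A n v p q) : ∀ t < n, Reach E Q A (t + 1) (v (t + 1)) (q t)
  | 0, ht => .start h.start (h.edge 0 ht)
  | t + 1, ht => .step (h.reach t (by omega)) (h.inner t ht) (h.edge _ ht)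

/-- A walk reaching the node of index `l` continues along the rest of the given walk. -/
theorem IsWalk.reach_append (h : IsWalk E Q A n v p q) {s l : ℕ} {d : Bool} (hl : l < n)
    (hr : Reach E Q A s (v l) d) (hq : Q (v l) d (p l)) :
    ∃ b, Reach E Q A (s + (n - l)) (v n) b := by
  have key : ∀ k, l + k < n → Reach E Q A (s + k + 1) (v (l + k + 1)) (q (l + k)) := by
    intro k
    induction k with
    | zero => exact fun hk => .step hr hq (h.edge _ hk)
    | succ k ih => exact fun hk => .step (ih (by omega)) (h.inner _ hk) (h.edge _ hk)
  refine ⟨q (n - 1), ?_⟩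
  have := key (n - 1 - l) (by omega)
  rwa [show s + (n - 1 - l) + 1 = s + (n - l) by omega, show l + (n - 1 - l) + 1 = n by omega,
    show l + (n - 1 - l) = n - 1 by omega] at this

end Walk

/-- On a walk of minimal length from `A` to `B` along generated edges, no node occurs twice
and no inner node can be bridged. -/
theorem exists_path_of_reach {H : MixedGraph V} {A B M S N X S' : Set V} (hH : H.IsRG)
    (hAB : Disjoint A B) (hN : Disjoint N (A ∪ B)) (hX : Disjoint X (A ∪ B))
    (hS : ∀ u v, H.anc u v → v ∈ S → u ∈ S) (hS' : ∀ u v, H.anc u v → v ∈ S' → u ∈ S')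
    (hSS' : S ⊆ S') (hXS' : X ⊆ S') (hXM : ∀ v ∈ X, v ∈ M → v ∈ S)
    (hS'X : ∀ v ∈ S', v ∉ A ∪ B → v ∉ M → v ∈ X) {n₀ : ℕ} {j₀ : V} {b₀ : Bool} (hj₀ : j₀ ∈ B)
    (hr₀ : Reach (fun i j a b => ∃ r, GenEdge H M S r i j a b) (Passes N X) A n₀ j₀ b₀) :
    ∃ n v p q, 0 < n ∧
      IsWalk (fun i j a b => ∃ r, GenEdge H M S r i j a b) (Passes N X) A n v p q ∧
      v n ∈ B ∧ (∀ k l, k < l → l ≤ n → v k ≠ v l) ∧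
      ∀ t, t + 1 < n → v (t + 1) ∉ M ∧ ¬ Passes M S (v (t + 1)) (q t) (p (t + 1)) := by
  classical
  have hwf : H.Wf := hH.1.1
  have hex : ∃ n, ∃ j ∈ B, ∃ b,
      Reach (fun i j a b => ∃ r, GenEdge H M S r i j a b) (Passes N X) A n j b :=
    ⟨n₀, j₀, hj₀, b₀, hr₀⟩
  set n := Nat.find hex with hn
  have hmin : ∀ m j b, j ∈ B →
      Reach (fun i j a b => ∃ r, GenEdge H M S r i j a b) (Passes N X) A m j b → n ≤ m :=
    fun m j b hj hr => Nat.find_min' hex ⟨j, hj, b, hr⟩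
  obtain ⟨j, hj, b, hr⟩ := Nat.find_spec hex
  obtain ⟨v, p, q, hw, rfl, -⟩ := hr.exists_isWalk
  rw [← hn] at hw hj hr
  have hnpos := hr.pos
  clear_value n
  have hinner : ∀ t, 0 < t → t < n → Passes N X (v t) (q (t - 1)) (p t) := by
    intro t ht htn
    obtain ⟨t, rfl⟩ := Nat.exists_eq_add_of_lt ht
    simpa using hw.inner t (by omega)
  have hnotAB : ∀ t, 0 < t → t < n → v t ∉ A ∪ B := by
    intro t ht htn hmem
    have hp := hinner t ht htn
    by_cases hc : q (t - 1) = true ∧ p t = true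
    · exact Set.disjoint_left.1 hX (hp.1 hc) hmem
    · exact Set.disjoint_left.1 hN (hp.2 hc) hmem
  have hcut : ∀ k l, 0 < k → k < l → l < n → v k = v l →
      ¬ Passes N X (v k) (q (k - 1)) (p l) := by
    intro k l hk hkl hln hv hp
    have h1 := hw.reach (k - 1) (by omega)
    rw [Nat.sub_add_cancel hk] at h1
    rw [hv] at h1 hp
    obtain ⟨b, h2⟩ := hw.reach_append hln h1 hp
    have := hmin _ _ _ hj h2
    omega
  have hsub : ∀ k l c d, k + 2 ≤ l → l ≤ n → (∃ r, GenEdge H M S r (v k) (v l) c d) →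
      (0 < k → Passes N X (v k) (q (k - 1)) c) → (l < n → Passes N X (v l) d (p l)) →
      False := by
    intro k l c d hkl hln he hk hl
    have h1 : Reach (fun i j a b => ∃ r, GenEdge H M S r i j a b) (Passes N X) A (k + 1)
        (v l) d := by
      obtain rfl | hk' := Nat.eq_zero_or_pos k
      · exact .start hw.start he
      · have h1 := hw.reach (k - 1) (by omega)
        rw [Nat.sub_add_cancel hk'] at h1
        exact .step h1 (hk hk') he
    obtain hln | rfl := hln.lt_or_eq
    · obtain ⟨b, h2⟩ := hw.reach_append hln h1 (hl hln)
      have := hmin _ _ _ hj h2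
      omega
    · have := hmin _ _ _ hj h1
      omega
  have hbridge : ∀ t, 0 < t → t < n → v (t - 1) ≠ v (t + 1) →
      ¬ Passes M S (v t) (q (t - 1)) (p t) := by
    intro t ht htn hne hp
    obtain ⟨t, rfl⟩ := Nat.exists_eq_add_of_lt ht
    simp only [zero_add, Nat.add_sub_cancel] at hp hne htn
    obtain ⟨r₁, e₁⟩ := hw.edge t (by omega)
    obtain ⟨r₂, e₂⟩ := hw.edge (t + 1) htn
    refine hsub t (t + 2) (p t) (q (t + 1)) le_rfl htn ⟨_, .comp hne hp e₁ e₂⟩ ?_ ?_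
    · exact fun h => hinner t h (by omega)
    · exact fun h => hinner (t + 2) (by omega) h
  have hnotM : ∀ t, 0 < t → t < n → v (t - 1) ≠ v (t + 1) → v t ∉ M := by
    intro t ht htn hne hM
    have hp := hinner t ht htn
    exact hbridge t ht htn hne ⟨fun hc => hXM _ (hp.1 hc) hM, fun _ => hM⟩
  have hinj : ∀ k l, k < l → l ≤ n → v k ≠ v l := by
    by_contra! hcon
    set k := Nat.find hcon with hk
    have hkmin : ∀ i < k, ∀ l, i < l → l ≤ n → v i ≠ v l := by
      intro i hi l hil hln hv
      exact Nat.find_min hcon hi ⟨l, hil, hln, hv⟩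
    obtain ⟨l₀, hkl₀, hl₀n, hv₀⟩ := Nat.find_spec hcon
    rw [← hk] at hkl₀ hv₀
    clear_value k
    obtain ⟨l, ⟨hkl, hln, hv⟩, hlmax⟩ : ∃ l, (k < l ∧ l ≤ n ∧ v k = v l) ∧
        ∀ m, l < m → m ≤ n → v k ≠ v m := by
      refine ⟨Nat.findGreatest (fun l => k < l ∧ l ≤ n ∧ v k = v l) n, ?_, ?_⟩
      · exact Nat.findGreatest_spec (P := fun l => k < l ∧ l ≤ n ∧ v k = v l) hl₀n
          ⟨hkl₀, hl₀n, hv₀⟩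
      · intro m hm hmn hv
        exact Nat.findGreatest_is_greatest hm hmn ⟨by
          have := Nat.le_findGreatest (P := fun l => k < l ∧ l ≤ n ∧ v k = v l) hl₀n
            ⟨hkl₀, hl₀n, hv₀⟩
          omega, hmn, hv⟩
    have hkpos : 0 < k := by
      by_contra hk0
      obtain rfl : k = 0 := by omega
      have hA := hw.start
      rw [hv] at hA
      obtain hln | rfl := hln.lt_or_eq
      · exact hnotAB l hkl hln (Or.inl hA)
      · exact Set.disjoint_left.1 hAB hA hj
    have hln' : l < n := by
      obtain hln | rfl := hln.lt_or_eq
      · exact hln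
      · exact (hnotAB k hkpos hkl (Or.inr (hv ▸ hj))).elim
    have hp1 := hinner k hkpos (by omega)
    have hp2 := hinner l (by omega) hln'
    have hfail := hcut k l hkpos hkl hln' hv
    have hkM : v k ∉ M := by
      refine hnotM k hkpos (by omega) ?_
      exact hkmin (k - 1) (by omega) (k + 1) (by omega) (by omega)
    have hnot : v k ∉ A ∪ B := hnotAB k hkpos (by omega)
    obtain ⟨hqk, hpl, hpk, hql, hkX⟩ :
        q (k - 1) = true ∧ p l = true ∧ p k = false ∧ q (l - 1) = false ∧ v k ∉ X := by
      rw [← hv] at hp2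
      exact hp1.cases_of_not_passes hp2 hfail
    have hkS' : v k ∉ S' := fun h => hkX (hS'X _ h hnot hkM)
    have htail : H.RibbonTail (v k) := by
      have key : ∀ s, k + s < n → v k ∈ S' ∨ H.RibbonTail (v k) ∨
          (q (k + s) = true ∧ H.anc (v k) (v (k + s + 1))) := by
        intro s
        induction s with
        | zero =>
          intro hs
          obtain ⟨r, e⟩ := hw.edge k (by omega)
          exact (e.tail_cases hS hpk).imp_left fun h => hSS' h
        | succ s ih =>
          intro hs
          obtain h | h | ⟨h1, h2⟩ := ih (by omega)
          · exact Or.inl h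
          · exact Or.inr (Or.inl h)
          obtain ⟨r, e⟩ := hw.edge (k + s + 1) hs
          have hps := hw.inner (k + s) hs
          cases hpp : p (k + s + 1)
          · obtain h | h | ⟨h3, h4⟩ := e.tail_cases hS hpp
            · exact Or.inl (hS' _ _ h2 (hSS' h))
            · exact Or.inr (Or.inl (ribbonTail_of_anc h2 h))
            · exact Or.inr (Or.inr ⟨h3, h2.trans h4⟩)
          · exact Or.inl (hS' _ _ h2 (hXS' (hps.1 ⟨h1, hpp⟩)))
      obtain h | h | ⟨h, -⟩ := key (l - 1 - k) (by omega)
      · exact (hkS' h).elim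
      · exact h
      · rw [show k + (l - 1 - k) = l - 1 by omega, hql] at h
        exact (Bool.false_ne_true h).elim
    obtain ⟨r₁, e₁⟩ := hw.edge (k - 1) (by omega)
    obtain ⟨r₂, e₂⟩ := hw.edge l hln'
    rw [Nat.sub_add_cancel hkpos, hqk] at e₁
    rw [← hv, hpl] at e₂
    have hne : v (k - 1) ≠ v (l + 1) := hkmin (k - 1) (by omega) (l + 1) (by omega) hln'
    have hleft : 0 < k - 1 → Passes N X (v (k - 1)) (q (k - 1 - 1)) (p (k - 1)) :=
      fun h => hinner _ h (by omega)
    have hright : l + 1 < n → Passes N X (v (l + 1)) (q l) (p (l + 1)) :=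
      fun h => hinner _ (by omega) h
    obtain he | ⟨r, c, -, e, hc⟩ | ⟨r, c, -, e, hc⟩ :=
      bypass hH hS le_rfl htail e₁ (e₂.symm hwf) hne
    · exact hsub (k - 1) (l + 1) _ _ (by omega) hln' he hleft hright
    · refine hsub (k - 1) (l + 1) _ _ (by omega) hln' ⟨r, e⟩ hleft fun hl => ?_
      have hM : v (l + 1) ∉ M := by
        refine hnotM (l + 1) (by omega) hl ?_
        rw [Nat.add_sub_cancel, ← hv]
        exact hlmax _ (by omega) (by omega)
      obtain hc | ⟨hc, rfl⟩ := hc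
      · exact (hM hc).elim
      · have hpr := hright hl
        exact ⟨fun _ => hS'X _ (hSS' hc) (hnotAB _ (by omega) hl) hM,
          fun hh => hpr.2 fun h2 => hh ⟨rfl, h2.2⟩⟩
    · refine hsub (k - 1) (l + 1) _ _ (by omega) hln' ⟨r, e⟩ (fun hk1 => ?_) hright
      have hM : v (k - 1) ∉ M := by
        refine hnotM (k - 1) hk1 (by omega) ?_
        exact hkmin _ (by omega) _ (by omega) (by omega)
      obtain hc | ⟨hc, rfl⟩ := hc
      · exact (hM hc).elim
      · have hpl := hleft hk1
        exact ⟨fun _ => hS'X _ (hSS' hc) (hnotAB _ hk1 (by omega)) hM,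
          fun hh => hpl.2 fun h2 => hh ⟨h2.1, rfl⟩⟩
  refine ⟨n, v, p, q, hnpos, hw, hj, hinj, fun t ht => ?_⟩
  have hne : v t ≠ v (t + 2) := hinj t (t + 2) (by omega) (by omega)
  exact ⟨hnotM (t + 1) (by omega) ht hne, hbridge (t + 1) (by omega) ht hne⟩

theorem IsWalk.exists_isPath {G : MixedGraph V} {A M C : Set V} {n : ℕ} {v : ℕ → V}
    {p q : ℕ → Bool} (hn : 0 < n)
    (hw : IsWalk (Edge G) (Passes M (C ∪ G.anSet C)) A n v p q)
    (hinj : ∀ k l, k < l → l ≤ n → v k ≠ v l) :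
    ∃ w, IsPath G (v 0) (v n) w ∧ MConnPath G M C w := by
  refine ⟨(List.range n).map fun t => ⟨v t, v (t + 1), p t, q t⟩, ⟨?_, ?_, ?_, ?_, ?_, ?_⟩, ?_⟩
  · simpa using hn.ne'
  · intro s hs
    obtain ⟨t, ht, rfl⟩ := List.mem_map.1 hs
    exact hw.edge t (List.mem_range.1 ht)
  · refine List.isChain_iff_getElem.2 fun t ht => ?_
    simp
  · obtain ⟨n, rfl⟩ := Nat.exists_eq_add_of_lt hn
    simp [List.range_succ_eq_map]
  · obtain ⟨n, rfl⟩ := Nat.exists_eq_add_of_lt hn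
    simp [List.range_succ]
  · have : v 0 :: ((List.range n).map fun t => (⟨v t, v (t + 1), p t, q t⟩ : Step V)).map
        Step.tgt = (List.range (n + 1)).map v := by
      simp [List.range_succ_eq_map]
    rw [this]
    refine List.Nodup.map_on ?_ List.nodup_range
    intro k hk l hl hv
    rw [List.mem_range] at hk hl
    obtain h | h | h := lt_trichotomy k l
    · exact (hinj k l h (by omega) hv).elim
    · exact h
    · exact (hinj l k h (by omega) hv.symm).elim
  · refine List.isChain_iff_getElem.2 fun t ht => ?_
    have ht' : t + 1 < n := by simpa using ht
    simpa [Passes] using hw.inner t ht'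

/-! ### Transferring walks between a graph and its closure -/

section Transfer

variable {H : MixedGraph V} {N X A B : Set V}

/-- A walk in `H` with passable inner nodes leads from `A` to `u`, arriving with mark `b`. -/
def Reaches (H : MixedGraph V) (N X A : Set V) (u : V) (b : Bool) : Prop :=
  ∃ n, Reach (Edge H) (Passes N X) A n u b

/-- A walk from `A` may leave `u` along an edge with mark `c` at `u`. -/
def Departs (H : MixedGraph V) (N X A : Set V) (u : V) (c : Bool) : Prop :=
  u ∈ A ∨ ∃ b, Reaches H N X A u b ∧ Passes N X u b c

/-- A walk in `H` with passable inner nodes leads from `A` to `B`. -/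
def Connects (H : MixedGraph V) (N X A B : Set V) : Prop := ∃ j ∈ B, ∃ b, Reaches H N X A j b

/-- A walk from `A` that arrives at `u` with an arrowhead can be modified so as to arrive
without one, unless `u` is a passable collider or lies in `A ∪ B`. -/
def Bounces (H : MixedGraph V) (N X A B : Set V) (u : V) : Prop :=
  u ∈ X ∨ u ∈ A ∪ B ∨ (Reaches H N X A u true → Connects H N X A B ∨ Reaches H N X A u false)

theorem Departs.reaches {u w : V} {c d : Bool} (h : Departs H N X A u c) (e : Edge H u w c d) :
    Reaches H N X A w d := by
  obtain h | ⟨b, ⟨n, h⟩, hp⟩ := h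
  · exact ⟨1, .start h e⟩
  · exact ⟨n + 1, .step h hp e⟩

theorem Reaches.connects_or_departs {u : V} {b c : Bool} (h : Reaches H N X A u b)
    (hu : u ∈ A ∪ B ∨ Passes N X u b c) : Connects H N X A B ∨ Departs H N X A u c := by
  obtain (hu | hu) | hu := hu
  · exact Or.inr (Or.inl hu)
  · exact Or.inl ⟨u, hu, b, h⟩
  · exact Or.inr (Or.inr ⟨b, h, hu⟩)

theorem passes_of_mem_left {v : V} {c d : Bool} (hv : v ∈ N) (h : ¬ (c = true ∧ d = true)) :
    Passes N X v c d := ⟨fun h' => (h h').elim, fun _ => hv⟩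

theorem Edge.bounces (hH : H.Wf) (hcov : ∀ v ∈ H.nodes, v ∉ A ∪ B → v ∉ X → v ∈ N)
    {u w : V} {b : Bool} (e : Edge H u w false b) (hf : b = false → w ∈ N)
    (ht : b = true → Bounces H N X A B w) : Bounces H N X A B u := by
  by_cases huX : u ∈ X
  · exact Or.inl huX
  by_cases huAB : u ∈ A ∪ B
  · exact Or.inr (Or.inl huAB)
  refine Or.inr (Or.inr fun hr => ?_)
  have huN : u ∈ N := hcov u (e.mem hH).1 huAB huX
  have hw : Reaches H N X A w b :=
    Departs.reaches (Or.inr ⟨_, hr, passes_of_mem_left huN (by simp)⟩) e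
  have back : Departs H N X A w b → Reaches H N X A u false := fun h => h.reaches (e.symm hH)
  cases b
  · exact Or.inr (back (Or.inr ⟨_, hw, passes_of_mem_left (hf rfl) (by simp)⟩))
  by_cases hwX : w ∈ X
  · exact Or.inr (back (Or.inr ⟨_, hw, fun _ => hwX, fun h => (h ⟨rfl, rfl⟩).elim⟩))
  by_cases hwAB : w ∈ A ∪ B
  · exact (hw.connects_or_departs (Or.inl hwAB)).imp_right back
  obtain h | h | h := ht rfl
  · exact (hwX h).elim
  · exact (hwAB h).elim
  · have hwN : w ∈ N := hcov w (e.mem hH).2 hwAB hwX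
    exact (h hw).imp_right fun h' =>
      back (Or.inr ⟨_, h', passes_of_mem_left hwN (by simp)⟩)

variable {M S : Set V}

theorem GenEdge.bounces (hH : H.Wf) (hcov : ∀ v ∈ H.nodes, v ∉ A ∪ B → v ∉ X → v ∈ N)
    (hMN : M ⊆ N) (hSX : ∀ v ∈ S, v ∉ A ∪ B → v ∈ X) {n : ℕ} {u w : V} {a b : Bool}
    (e : GenEdge H M S n u w a b) (ha : a = false) (hf : b = false → w ∈ N)
    (ht : b = true → Bounces H N X A B w) : Bounces H N X A B u := by
  induction e with
  | base e =>
    subst ha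
    exact e.bounces hH hcov hf ht
  | @comp i m j a b c d p q _ hp _ _ ih1 ih2 =>
    refine ih1 ha ?_ ?_
    · rintro rfl
      exact hMN (hp.2 (by simp))
    · rintro rfl
      cases d
      · exact ih2 rfl hf ht
      · by_cases hm : m ∈ A ∪ B
        · exact Or.inr (Or.inl hm)
        · exact Or.inl (hSX m (hp.1 ⟨rfl, rfl⟩) hm)

theorem Departs.connects_or_reaches (hMN : M ⊆ N) (hSX : ∀ v ∈ S, v ∉ A ∪ B → v ∈ X) {n : ℕ}
    {u w : V} {c d : Bool} (e : GenEdge H M S n u w c d) (h : Departs H N X A u c) :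
    Connects H N X A B ∨ Reaches H N X A w d := by
  induction e with
  | base e => exact Or.inr (h.reaches e)
  | @comp i m j a b c d p q _ hp _ _ ih1 ih2 =>
    obtain h1 | h1 := ih1 h
    · exact Or.inl h1
    have hm : m ∈ A ∪ B ∨ Passes N X m c d := by
      by_cases hm : m ∈ A ∪ B
      · exact Or.inl hm
      · exact Or.inr ⟨fun h => hSX m (hp.1 h) hm, fun h => hMN (hp.2 h)⟩
    obtain h2 | h2 := h1.connects_or_departs hm
    · exact Or.inl h2
    · exact ih2 h2

/-- A path in `G` from `A` to `B` yields a walk in `H`, provided every edge and every inner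
node of the path can be followed. -/
theorem connects_of_isPath {G : MixedGraph V} {P : V → Bool → Bool → Prop}
    (hedge : ∀ u w c d, Departs H N X A u c → Edge G u w c d →
      Connects H N X A B ∨ Reaches H N X A w d)
    (hnode : ∀ u b c, Reaches H N X A u b → P u b c →
      Connects H N X A B ∨ Departs H N X A u c)
    {i j : V} (hi : i ∈ A) (hj : j ∈ B) {w : List (Step V)} (hw : IsPath G i j w)
    (hc : List.IsChain (fun a b => P a.tgt a.ht b.hs) w) : Connects H N X A B := by
  obtain ⟨hne, hval, hch, hhead, hlast, -⟩ := hw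
  replace hch : List.IsChain (fun a b : Step V => a.tgt = b.src) w := hch
  have key : ∀ (l : List (Step V)) (s : Step V), (∀ x ∈ s :: l, x.valid G) →
      List.IsChain (fun a b : Step V => a.tgt = b.src) (s :: l) →
      List.IsChain (fun a b => P a.tgt a.ht b.hs) (s :: l) →
      ((s :: l).getLast?.map Step.tgt = some j) → Departs H N X A s.src s.hs →
      Connects H N X A B := by
    intro l
    induction l with
    | nil =>
      intro s hv _ _ hl hd
      obtain h | h := hedge _ _ _ _ hd (hv s (by simp))
      · exact h
      · refine ⟨s.tgt, ?_, _, h⟩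
        have : s.tgt = j := by simpa using hl
        rwa [this]
    | cons s' l ih =>
      intro s hv h1 h2 hl hd
      rw [List.isChain_cons_cons] at h1 h2
      obtain h | h := hedge _ _ _ _ hd (hv s (by simp))
      · exact h
      obtain h | h := hnode _ _ _ h h2.1
      · exact h
      rw [h1.1] at h
      exact ih s' (fun x hx => hv x (List.mem_cons_of_mem _ hx)) h1.2 h2.2 (by simpa using hl) h
  cases w with
  | nil => exact (hne rfl).elim
  | cons s l =>
    refine key l s hval hch hc hlast (Or.inl ?_)
    have : s.src = i := by simpa using hhead
    rwa [this]

end Transfer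

theorem mem_anSet_closed {H : MixedGraph V} {C : Set V} (u v : V) (h : H.anc u v)
    (hv : v ∈ C ∪ H.anSet C) : u ∈ C ∪ H.anSet C := by
  obtain hv | ⟨c, hc, hvc⟩ := hv
  · exact Or.inr ⟨v, hv, h⟩
  · exact Or.inr ⟨c, hc, h.trans hvc⟩

/-- An ancestor of `C₁` outside `S` that survives marginalisation is an ancestor of `C₁` in
the generated graph. -/
theorem mem_anSet_alphaRG {H : MixedGraph V} {M C C₁ : Set V} (hH : H.IsLMG)
    (hC₁ : ∀ c ∈ C₁, c ∈ (alphaRG H M C).nodes) {u c : V} (hc : c ∈ C₁) (h : H.anc u c)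
    (hu : u ∉ C ∪ H.anSet C) (huM : u ∉ M) : u ∈ C₁ ∪ (alphaRG H M C).anSet C₁ := by
  suffices key : u ∉ C ∪ H.anSet C → ∃ w ∈ (alphaRG H M C).nodes,
      w ∈ C₁ ∪ (alphaRG H M C).anSet C₁ ∧
      (u = w ∨ (u ∈ M ∧ ∃ n, GenEdge H M (C ∪ H.anSet C) n u w false true)) by
    obtain ⟨w, -, hw, rfl | ⟨h, -⟩⟩ := key hu
    · exact hw
    · exact (huM h).elim
  clear hu huM
  have step : ∀ {u u' : V}, H.arrow u u' → (u' ∉ C ∪ H.anSet C → ∃ w ∈ (alphaRG H M C).nodes,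
      w ∈ C₁ ∪ (alphaRG H M C).anSet C₁ ∧
      (u' = w ∨ (u' ∈ M ∧ ∃ n, GenEdge H M (C ∪ H.anSet C) n u' w false true))) →
      u ∉ C ∪ H.anSet C → ∃ w ∈ (alphaRG H M C).nodes,
      w ∈ C₁ ∪ (alphaRG H M C).anSet C₁ ∧
      (u = w ∨ (u ∈ M ∧ ∃ n, GenEdge H M (C ∪ H.anSet C) n u w false true)) := by
    intro u u' ha ih hu
    have he : Edge H u u' false true := ha
    obtain ⟨w, hwK, hw, hw'⟩ := ih fun h => hu (mem_anSet_closed u u' (.single ha) h)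
    have hgen : u = w ∨ ∃ n, GenEdge H M (C ∪ H.anSet C) n u w false true := by
      by_cases huw : u = w
      · exact Or.inl huw
      obtain rfl | ⟨hM, n, e⟩ := hw'
      · exact Or.inr ⟨1, .base he⟩
      · exact Or.inr ⟨_, .comp huw (passes_of_mem_left hM (by simp)) (.base he) e⟩
    by_cases huM : u ∈ M
    · refine ⟨w, hwK, hw, Or.inr ⟨huM, ?_⟩⟩
      obtain rfl | h := hgen
      · exact (hwK.2 (Or.inl huM)).elim
      · exact h
    · have huK : u ∈ (alphaRG H M C).nodes :=
        ⟨(he.mem hH.1).1, fun h => h.elim huM fun h => hu (Or.inl h)⟩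
      refine ⟨u, huK, ?_, Or.inl rfl⟩
      obtain rfl | h := hgen
      · exact hw
      · exact mem_anSet_closed u w (.single ((edge_alphaRG_iff hH.1).2 ⟨huK, hwK, h⟩)) hw
  induction h using Relation.TransGen.head_induction_on with
  | single h => exact step h fun _ => ⟨c, hC₁ c hc, Or.inl hc, Or.inl rfl⟩
  | head h _ ih => exact step h ih

section Main

variable {H : MixedGraph V} {A B C C₁ M : Set V}

/-- If `A` and `B` are connected by a path in `H`, then they are in the generated graph. -/
theorem exists_isPath_alphaRG (hH : H.IsRG)
    (hA : A ⊆ H.nodes) (hB : B ⊆ H.nodes) (hC₁ : C₁ ⊆ H.nodes) (hM : M ⊆ H.nodes)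
    (hAB : Disjoint A B) (hAC : Disjoint A C) (hAC₁ : Disjoint A C₁)
    (hAM : Disjoint A M) (hBC : Disjoint B C) (hBC₁ : Disjoint B C₁)
    (hBM : Disjoint B M) (hCC₁ : Disjoint C C₁) (hCM : Disjoint C M)
    (hC₁M : Disjoint C₁ M) {i j : V} (hi : i ∈ A) (hj : j ∈ B) {w : List (Step V)}
    (hw : IsPath H i j w) (hc : MConnPath H (H.nodes \ (A ∪ B ∪ (C ∪ C₁))) (C ∪ C₁) w) :
    ∃ i ∈ A, ∃ j ∈ B, ∃ w, IsPath (alphaRG H M C) i j w ∧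
      MConnPath (alphaRG H M C) ((alphaRG H M C).nodes \ (A ∪ B ∪ C₁)) C₁ w := by
  rw [Set.disjoint_left] at hAC hAC₁ hAM hBC hBC₁ hBM hCC₁ hCM hC₁M
  set N := H.nodes \ (A ∪ B ∪ (C ∪ C₁)) with hN
  set S := C ∪ H.anSet C with hS
  set S' := (C ∪ C₁) ∪ H.anSet (C ∪ C₁) with hS'
  let X : Set V := {v | v ∈ S' ∧ v ∉ A ∪ B ∧ (v ∈ M → v ∈ S)}
  have hwf : H.Wf := hH.1.1
  have hCX : ∀ v ∈ C ∪ C₁, v ∈ X := by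
    intro v hv
    refine ⟨Or.inl hv, ?_, fun hvM => ?_⟩
    · rintro (h | h) <;> rcases hv with hv | hv
      exacts [hAC h hv, hAC₁ h hv, hBC h hv, hBC₁ h hv]
    · rcases hv with hv | hv
      exacts [(hCM hv hvM).elim, (hC₁M hv hvM).elim]
  have hcov : ∀ v ∈ H.nodes, v ∉ A ∪ B → v ∉ X → v ∈ N := fun v hv h1 h2 =>
    ⟨hv, fun h => h.elim h1 fun h => h2 (hCX v h)⟩
  have hMN : M ⊆ N := by
    intro v hv
    refine ⟨hM hv, ?_⟩
    rintro ((h | h) | (h | h))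
    exacts [hAM h hv, hBM h hv, hCM h hv, hC₁M h hv]
  have hSS' : S ⊆ S' := by
    rintro v (h | ⟨c, hc, h⟩)
    exacts [Or.inl (Or.inl h), Or.inr ⟨c, Or.inl hc, h⟩]
  have hbounce : ∀ u c, c ∈ C ∪ C₁ → H.anc u c → Bounces H N X A B u := by
    intro u c hc h
    induction h using Relation.TransGen.head_induction_on with
    | single h =>
      exact Edge.bounces hwf hcov (b := true) h (by simp) fun _ => Or.inl (hCX c hc)
    | head h _ ih => exact Edge.bounces hwf hcov (b := true) h (by simp) fun _ => ih
  have hconn : Connects H N X A B := by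
    refine connects_of_isPath (P := Passes N S') (fun u w c d hd e => Or.inr (hd.reaches e))
      ?_ hi hj hw hc
    intro u b c hr hp
    by_cases hu : u ∈ A ∪ B
    · exact hr.connects_or_departs (Or.inl hu)
    by_cases huX : u ∈ X
    · exact hr.connects_or_departs (Or.inr ⟨fun _ => huX, hp.2⟩)
    by_cases hbc : b = true ∧ c = true
    · obtain ⟨rfl, rfl⟩ := hbc
      obtain h | ⟨c, hc, h⟩ := hp.1 ⟨rfl, rfl⟩
      · exact (huX (hCX u h)).elim
      obtain h | h | h := hbounce u c hc h
      · exact (huX h).elim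
      · exact (hu h).elim
      obtain h | h := h hr
      · exact Or.inl h
      · obtain ⟨n, h'⟩ := hr
        have huH : u ∈ H.nodes := by
          cases h' with
          | start _ e => exact (e.mem hwf).2
          | step _ _ e => exact (e.mem hwf).2
        exact h.connects_or_departs
          (Or.inr (passes_of_mem_left (hcov u huH hu huX) (by simp)))
    · exact hr.connects_or_departs (Or.inr (passes_of_mem_left (hp.2 hbc) hbc))
  obtain ⟨j, hj, b, n, hr⟩ := hconn
  have hr' : Reach (fun i j a b => ∃ r, GenEdge H M S r i j a b) (Passes N X) A n j b :=
    hr.mono fun i j a b e => ⟨1, .base e⟩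
  obtain ⟨n, v, p, q, hn, hwalk, hvn, hinj, hinner⟩ :=
    exists_path_of_reach (M := M) (S := S) (S' := S') (N := N) (X := X) hH hAB
      (Set.disjoint_left.2 fun v hv h => hv.2 (Or.inl h))
      (Set.disjoint_left.2 fun v hv h => hv.2.1 h)
      mem_anSet_closed mem_anSet_closed hSS' (fun v hv => hv.1) (fun v hv => hv.2.2)
      (fun v h1 h2 h3 => ⟨h1, h2, fun h => (h3 h).elim⟩) hj hr'
  have hnodes : ∀ t ≤ n, v t ∈ H.nodes := by
    intro t ht
    obtain ht | rfl := ht.lt_or_eq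
    · obtain ⟨r, e⟩ := hwalk.edge t ht
      exact (e.mem hwf).1
    · exact hB hvn
  have hC₁K : ∀ c ∈ C₁, c ∈ (alphaRG H M C).nodes := fun c hc =>
    ⟨hC₁ hc, fun h => h.elim (hC₁M hc) fun h => hCC₁ h hc⟩
  have hinnerK : ∀ t, t + 1 < n → v (t + 1) ∈ (alphaRG H M C).nodes ∧
      Passes ((alphaRG H M C).nodes \ (A ∪ B ∪ C₁)) (C₁ ∪ (alphaRG H M C).anSet C₁)
        (v (t + 1)) (q t) (p (t + 1)) := by
    intro t ht
    obtain ⟨hvM, hnp⟩ := hinner t ht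
    have hp := hwalk.inner t ht
    by_cases hqp : q t = true ∧ p (t + 1) = true
    · have hvS : v (t + 1) ∉ S := fun h => hnp ⟨fun _ => h, fun h => (h hqp).elim⟩
      refine ⟨⟨hnodes _ ht.le, fun h => h.elim hvM fun h => hvS (Or.inl h)⟩,
        fun _ => ?_, fun h => (h hqp).elim⟩
      obtain ⟨(h | h) | ⟨c, hc | hc, h⟩, -⟩ := hp.1 hqp
      · exact (hvS (Or.inl h)).elim
      · exact Or.inl h
      · exact (hvS (Or.inr ⟨c, hc, h⟩)).elim
      · exact mem_anSet_alphaRG hH.1 hC₁K hc h hvS hvM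
    · have hvN := hp.2 hqp
      have hvK : v (t + 1) ∈ (alphaRG H M C).nodes :=
        ⟨hvN.1, fun h => h.elim hvM fun h => hvN.2 (Or.inr (Or.inl h))⟩
      refine ⟨hvK, passes_of_mem_left ⟨hvK, fun h => hvN.2 ?_⟩ hqp⟩
      exact h.imp_right Or.inr
  have hnodesK : ∀ t ≤ n, v t ∈ (alphaRG H M C).nodes := by
    intro t ht
    obtain ht | rfl := ht.lt_or_eq
    · cases t with
      | zero => exact ⟨hA hwalk.start, fun h => h.elim (hAM hwalk.start) (hAC hwalk.start)⟩
      | succ t => exact (hinnerK t ht).1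
    · exact ⟨hB hvn, fun h => h.elim (hBM hvn) (hBC hvn)⟩
  have hwK : IsWalk (Edge (alphaRG H M C))
      (Passes ((alphaRG H M C).nodes \ (A ∪ B ∪ C₁)) (C₁ ∪ (alphaRG H M C).anSet C₁))
      A n v p q :=
    ⟨hwalk.start, fun t ht => (edge_alphaRG_iff hwf).2
      ⟨hnodesK t ht.le, hnodesK (t + 1) ht, hwalk.edge t ht⟩, fun t ht => (hinnerK t ht).2⟩
  exact ⟨_, hwalk.start, _, hvn, hwK.exists_isPath hn hinj⟩

/-- If `A` and `B` are connected by a path in the generated graph, then they are in `H`. -/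
theorem exists_isPath_of_alphaRG (hH : H.IsRG) (hM : M ⊆ H.nodes)
    (hAB : Disjoint A B) (hAC : Disjoint A C) (hAC₁ : Disjoint A C₁)
    (hAM : Disjoint A M) (hBC : Disjoint B C) (hBC₁ : Disjoint B C₁)
    (hBM : Disjoint B M) (hCM : Disjoint C M)
    (hC₁M : Disjoint C₁ M) {i j : V} (hi : i ∈ A) (hj : j ∈ B) {w : List (Step V)}
    (hw : IsPath (alphaRG H M C) i j w)
    (hc : MConnPath (alphaRG H M C) ((alphaRG H M C).nodes \ (A ∪ B ∪ C₁)) C₁ w) :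
    ∃ i ∈ A, ∃ j ∈ B, ∃ w, IsPath H i j w ∧
      MConnPath H (H.nodes \ (A ∪ B ∪ (C ∪ C₁))) (C ∪ C₁) w := by
  rw [Set.disjoint_left] at hAC hAC₁ hAM hBC hBC₁ hBM hCM hC₁M
  set N := H.nodes \ (A ∪ B ∪ (C ∪ C₁)) with hN
  set S := C ∪ H.anSet C with hS
  set S' := (C ∪ C₁) ∪ H.anSet (C ∪ C₁) with hS'
  let X : Set V := {v | v ∈ S' ∧ v ∉ A ∪ B}
  have hwf : H.Wf := hH.1.1
  have hCX : ∀ v ∈ C ∪ C₁, v ∈ X := by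
    intro v hv
    refine ⟨Or.inl hv, ?_⟩
    rintro (h | h) <;> rcases hv with hv | hv
    exacts [hAC h hv, hAC₁ h hv, hBC h hv, hBC₁ h hv]
  have hcov : ∀ v ∈ H.nodes, v ∉ A ∪ B → v ∉ X → v ∈ N := fun v hv h1 h2 =>
    ⟨hv, fun h => h.elim h1 fun h => h2 (hCX v h)⟩
  have hMN : M ⊆ N := by
    intro v hv
    refine ⟨hM hv, ?_⟩
    rintro ((h | h) | (h | h))
    exacts [hAM h hv, hBM h hv, hCM h hv, hC₁M h hv]
  have hSX : ∀ v ∈ S, v ∉ A ∪ B → v ∈ X := by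
    rintro v (h | ⟨c, hc, h⟩) hv
    exacts [⟨Or.inl (Or.inl h), hv⟩, ⟨Or.inr ⟨c, Or.inl hc, h⟩, hv⟩]
  have hbounce : ∀ u c, c ∈ C₁ → (alphaRG H M C).anc u c → Bounces H N X A B u := by
    intro u c hc h
    induction h using Relation.TransGen.head_induction_on with
    | single h =>
      obtain ⟨n, e⟩ := h.2.2.exists_genEdge hwf
      exact e.bounces hwf hcov hMN hSX rfl (by simp) fun _ => Or.inl (hCX _ (Or.inr hc))
    | head h _ ih =>
      obtain ⟨n, e⟩ := h.2.2.exists_genEdge hwf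
      exact e.bounces hwf hcov hMN hSX rfl (by simp) fun _ => ih
  have hconn : Connects H N X A B := by
    refine connects_of_isPath (P := Passes ((alphaRG H M C).nodes \ (A ∪ B ∪ C₁))
      (C₁ ∪ (alphaRG H M C).anSet C₁)) ?_ ?_ hi hj hw hc
    · intro u w c d hd e
      obtain ⟨-, -, n, e⟩ := (edge_alphaRG_iff hwf).1 e
      exact hd.connects_or_reaches hMN hSX e
    · intro u b c hr hp
      by_cases hu : u ∈ A ∪ B
      · exact hr.connects_or_departs (Or.inl hu)
      by_cases hbc : b = true ∧ c = true
      · obtain ⟨rfl, rfl⟩ := hbc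
        by_cases huX : u ∈ X
        · exact hr.connects_or_departs (Or.inr ⟨fun _ => huX, fun h => (h ⟨rfl, rfl⟩).elim⟩)
        obtain h | ⟨c, hc, h⟩ := hp.1 ⟨rfl, rfl⟩
        · exact (huX (hCX u (Or.inr h))).elim
        obtain h | h | h := hbounce u c hc h
        · exact (huX h).elim
        · exact (hu h).elim
        obtain h | h := h hr
        · exact Or.inl h
        · obtain ⟨n, h'⟩ := hr
          have huH : u ∈ H.nodes := by
            cases h' with
            | start _ e => exact (e.mem hwf).2
            | step _ _ e => exact (e.mem hwf).2
          exact h.connects_or_departs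
            (Or.inr (passes_of_mem_left (hcov u huH hu huX) (by simp)))
      · obtain ⟨⟨hu1, hu2⟩, hu3⟩ := hp.2 hbc
        refine hr.connects_or_departs (Or.inr (passes_of_mem_left ⟨hu1, ?_⟩ hbc))
        rintro (h | h | h)
        exacts [hu h, hu2 (Or.inr h), hu3 (Or.inr h)]
  obtain ⟨j, hj, b, n, hr⟩ := hconn
  have hr' : Reach (fun i j a b => ∃ r, GenEdge H ∅ ∅ r i j a b) (Passes N X) A n j b :=
    hr.mono fun i j a b e => ⟨1, .base e⟩
  obtain ⟨n, v, p, q, hn, hwalk, hvn, hinj, -⟩ :=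
    exists_path_of_reach (M := ∅) (S := ∅) (S' := S') (N := N) (X := X) hH hAB
      (Set.disjoint_left.2 fun v hv h => hv.2 (Or.inl h))
      (Set.disjoint_left.2 fun v hv h => hv.2 h)
      (by simp) mem_anSet_closed (by simp) (fun v hv => hv.1) (by simp)
      (fun v h1 h2 _ => ⟨h1, h2⟩) hj hr'
  have hwH : IsWalk (Edge H) (Passes N S') A n v p q := by
    refine ⟨hwalk.start, fun t ht => ?_, fun t ht => ?_⟩
    · obtain ⟨r, e⟩ := hwalk.edge t ht
      exact e.edge_of_empty
    · have hp := hwalk.inner t ht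
      exact ⟨fun h => (hp.1 h).1, hp.2⟩
  exact ⟨_, hwalk.start, _, hvn, hwH.exists_isPath hn hinj⟩

end Main

/-- (Theorem 2) Graphs generated by `α_RG` induce the
marginal and conditional independence model: for a ribbonless graph `H` and
pairwise disjoint subsets `A`, `B`, `C`, `C₁`, `M` of its node set,
`A ⊥_m B | C₁` holds in `α_RG(H;M,C)` iff `A ⊥_m B | C ∪ C₁` holds in `H`. -/
theorem stmt_4 {V : Type} (H : MixedGraph V) (A B C C₁ M : Set V)
    (hH : H.IsRG)
    (hA : A ⊆ H.nodes) (hB : B ⊆ H.nodes) (hC : C ⊆ H.nodes)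
    (hC₁ : C₁ ⊆ H.nodes) (hM : M ⊆ H.nodes)
    (hAB : Disjoint A B) (hAC : Disjoint A C) (hAC₁ : Disjoint A C₁)
    (hAM : Disjoint A M) (hBC : Disjoint B C) (hBC₁ : Disjoint B C₁)
    (hBM : Disjoint B M) (hCC₁ : Disjoint C C₁) (hCM : Disjoint C M)
    (hC₁M : Disjoint C₁ M) :
    MSep (alphaRG H M C) A B C₁ ↔ MSep H A B (C ∪ C₁) := by
  constructor
  · intro h i hi j hj w hw hc
    obtain ⟨i, hi, j, hj, w, hw, hc⟩ := exists_isPath_alphaRG hH hA hB hC₁ hM hAB hAC hAC₁ hAM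
      hBC hBC₁ hBM hCC₁ hCM hC₁M hi hj hw hc
    exact h i hi j hj w hw hc
  · intro h i hi j hj w hw hc
    obtain ⟨i, hi, j, hj, w, hw, hc⟩ := exists_isPath_of_alphaRG hH hM hAB hAC hAC₁ hAM
      hBC hBC₁ hBM hCM hC₁M hi hj hw hc
    exact h i hi j hj w hw hc

end StableMixedGraphs
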